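/- Fix m ≥ 2. On ℝ^{2m+1} with coordinates (a_1,…,a_{m+1}, b_1,…,b_m), let π_1 be the skew-symmetric matrix-valued map determined by {a_1,b_1} = a_1, {a_j,b_j} = (1/2)a_j for j = 2,…,m, {a_{j+1},b_j} = −(1/2)a_{j+1} for j = 1,…,m−1, {a_{m+1},b_m} = −a_{m+1}, all other brackets zero. Let L(a,b) be the symmetric 2m×2m matrix with diagonal entries b_k at position (2k−1,2k−1) and −b_k at (2k,2k) for 1 ≤ k ≤ m, entries a_1 at (1,2), a_{m+1} at (2m−1,2m), a_{k+1} at (2k−1,2k+1) and −a_{k+1} at (2k,2k+2) for 1 ≤ k ≤ m−1 (and symmetric counterparts), all other entries zero, and set H_{2k}(a,b) = (1/(2k))·trace(L(a,b)^{2k}). Then for all 1 ≤ i, j ≤ m, the functions H_{2i} and H_{2j} are in involution with respect to π_1: (∇H_{2i})ᵀ · π_1 · ∇H_{2j} = 0 at every point of ℝ^{2m+1}. -/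

import Mathlib

/-- The `a`-coordinates (1-based `j`, `1 ≤ j ≤ m+1`) on `ℝ^{2m+1}` with coordinates
`(a_1, …, a_{m+1}, b_1, …, b_m)`. -/
noncomputable def aV (m : ℕ) (x : Fin (2*m+1) → ℝ) (j : ℕ) : ℝ :=
  if h : 1 ≤ j ∧ j ≤ m + 1 then x ⟨j - 1, by omega⟩ else 0

/-- The `b`-coordinates (1-based `j`, `1 ≤ j ≤ m`) on `ℝ^{2m+1}`. -/
noncomputable def bV (m : ℕ) (x : Fin (2*m+1) → ℝ) (j : ℕ) : ℝ :=
  if h : 1 ≤ j ∧ j ≤ m then x ⟨m + j, by omega⟩ else 0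

/-- The linear bracket `{a_i, b_j}` of `π₁`: `{a_1,b_1} = a_1`, `{a_j,b_j} = (1/2)a_j`
(`2 ≤ j ≤ m`), `{a_{j+1},b_j} = -(1/2)a_{j+1}` (`1 ≤ j ≤ m-1`), `{a_{m+1},b_m} = -a_{m+1}`. -/
noncomputable def pi1ab (m : ℕ) (x : Fin (2*m+1) → ℝ) (i j : ℕ) : ℝ :=
  if i = 1 ∧ j = 1 then aV m x 1
  else if 2 ≤ i ∧ i ≤ m ∧ j = i then (1/2) * aV m x i
  else if i = j + 1 ∧ 1 ≤ j ∧ j ≤ m - 1 then -((1/2) * aV m x i)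
  else if i = m + 1 ∧ j = m then -(aV m x (m+1))
  else 0

/-- The skew-symmetric Poisson matrix `π₁` on `ℝ^{2m+1}`; the first `m+1` (0-based)
indices are the `a`-coordinates, the last `m` are the `b`-coordinates. -/
noncomputable def pi1M (m : ℕ) (x : Fin (2*m+1) → ℝ) :
    Matrix (Fin (2*m+1)) (Fin (2*m+1)) ℝ :=
  fun p q =>
    if (p : ℕ) ≤ m ∧ m < (q : ℕ) then pi1ab m x ((p : ℕ) + 1) ((q : ℕ) - m)
    else if (q : ℕ) ≤ m ∧ m < (p : ℕ) then -(pi1ab m x ((q : ℕ) + 1) ((p : ℕ) - m))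
    else 0

/-- Strictly-upper-triangular entries (1-based `i < j`) of the symmetric Lax matrix `L`:
`L_{1,2} = a_1`, `L_{2m-1,2m} = a_{m+1}`, `L_{2k-1,2k+1} = a_{k+1}`,
`L_{2k,2k+2} = -a_{k+1}` for `1 ≤ k ≤ m-1`. -/
noncomputable def LentU (m : ℕ) (a : ℕ → ℝ) (i j : ℕ) : ℝ :=
  if i = 1 ∧ j = 2 then a 1
  else if i = 2*m - 1 ∧ j = 2*m then a (m+1)
  else if j = i + 2 ∧ i % 2 = 1 ∧ i ≤ 2*m - 3 then a ((i+1)/2 + 1)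
  else if j = i + 2 ∧ i % 2 = 0 ∧ 1 ≤ i ∧ i ≤ 2*m - 2 then -(a (i/2 + 1))
  else 0

/-- Entry (1-based) of the symmetric Lax matrix `L`: diagonal `L_{2k-1,2k-1} = b_k`,
`L_{2k,2k} = -b_k`; off-diagonal entries via `LentU` and symmetry. -/
noncomputable def Lent (m : ℕ) (a b : ℕ → ℝ) (i j : ℕ) : ℝ :=
  if i = j then (if i % 2 = 1 then b ((i+1)/2) else -(b (i/2)))
  else if i < j then LentU m a i j
  else LentU m a j i

/-- The symmetric `2m × 2m` Lax matrix `L`. -/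
noncomputable def LMat (m : ℕ) (a b : ℕ → ℝ) : Matrix (Fin (2*m)) (Fin (2*m)) ℝ :=
  fun i j => Lent m a b ((i : ℕ) + 1) ((j : ℕ) + 1)

/-- The Lax matrix `L` as a function of the point `x = (a, b) ∈ ℝ^{2m+1}`. -/
noncomputable def LMx (m : ℕ) (x : Fin (2*m+1) → ℝ) : Matrix (Fin (2*m)) (Fin (2*m)) ℝ :=
  LMat m (fun j => aV m x j) (fun j => bV m x j)

/-- `H_{2k} = (1/(2k)) trace(L^{2k})`. -/
noncomputable def H2k (m k : ℕ) (x : Fin (2*m+1) → ℝ) : ℝ :=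
  (1 / (2 * k : ℝ)) * Matrix.trace ((LMx m x) ^ (2*k))


theorem core_cyc {G : Type*} [AddCommGroup G] [Fintype G] (g : G)
    (hgen : ∀ P : G → Prop, P 0 → (∀ x, P x → P (x + g)) → ∀ x, P x)
    (α β : G → ℝ) (M N : G → G → ℝ) (hMs : ∀ i j, M i j = M j i) (hNs : ∀ i j, N i j = N j i)
    (hM : ∀ i j, β i * M i j + α (i + g) * M (i + g) j + α i * M (i - g) j
      = β j * M i j + α (j + g) * M i (j + g) + α j * M i (j - g))
    (hN : ∀ i j, β i * N i j + α (i + g) * N (i + g) j + α i * N (i - g) j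
      = β j * N i j + α (j + g) * N i (j + g) + α j * N i (j - g))
    (hMN : ∀ i k, ∑ j, M i j * N j k = ∑ j, N i j * M j k) :
    ∑ i, α (i + g) * (M i (i + g) * (N (i + g) (i + g) - N i i)
      - N i (i + g) * (M (i + g) (i + g) - M i i)) = 0 := by
  obtain ⟨J, hJ⟩ : ∃ J : G → G → ℝ, ∀ i j, J i j =
    α (i + g) * (M i j * N (i + g) j - N i j * M (i + g) j) := ⟨_, fun _ _ => rfl⟩
  have key : ∀ i j, J i j - J (i - g) j = J j i - J (j - g) i := by
    intro i j
    simp only [hJ, sub_add_cancel]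
    rw [hMs j i, hNs j i, hMs (j + g) i, hNs (j + g) i, hMs (j - g) i, hNs (j - g) i]
    linear_combination M i j * hN i j - N i j * hM i j
  obtain ⟨c, hc⟩ : ∃ c : G → ℝ, ∀ d, c d = ∑ i, J i (i + d) := ⟨_, fun _ => rfl⟩
  have hcd : ∀ d, c d - c (d + g) = c (-d) - c (g - d) := by
    intro d
    have h := Finset.sum_congr rfl (fun i (_ : i ∈ Finset.univ) => key i (i + d))
    rw [Finset.sum_sub_distrib, Finset.sum_sub_distrib] at h
    have h2 : ∑ i, J (i - g) (i + d) = c (d + g) := by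
      rw [hc, ← Equiv.sum_comp (Equiv.addRight g)]
      refine Finset.sum_congr rfl fun i _ => ?_
      simp only [Equiv.coe_addRight, add_sub_cancel_right]
      congr 1; abel
    have h3 : ∑ i, J (i + d) i = c (-d) := by
      rw [hc, ← Equiv.sum_comp (Equiv.addRight d) (fun i => J i (i + -d))]
      refine Finset.sum_congr rfl fun i _ => ?_
      simp
    have h4 : ∑ i, J (i + d - g) i = c (g - d) := by
      rw [hc, ← Equiv.sum_comp (Equiv.addRight (d - g)) (fun i => J i (i + (g - d)))]
      refine Finset.sum_congr rfl fun i _ => ?_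
      simp only [Equiv.coe_addRight]
      congr 1 <;> abel
    rw [h2, h3, h4, ← hc] at h
    exact h
  have he : ∀ d, c d + c (g - d) = c 0 + c g := by
    apply hgen
    · simp
    · intro d hd
      have := hcd d
      have e : g - (d + g) = -d := by abel
      rw [e]; linarith
  have hsum : ∑ d, c d = 0 := by
    simp only [hc]
    rw [Finset.sum_comm]
    apply Finset.sum_eq_zero
    intro i _
    have hre : ∑ d, J i (i + d) = ∑ j, J i j := Equiv.sum_comp (Equiv.addLeft i) (fun j => J i j)
    rw [hre]
    simp only [hJ]
    rw [← Finset.mul_sum, Finset.sum_sub_distrib]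
    have := hMN i (i + g)
    simp only [hMs _ (i + g), hNs _ (i + g)] at this
    rw [this, sub_self, mul_zero]
  have htot : ∑ d, (c d + c (g - d)) = 0 := by
    have hre : ∑ d, c (g - d) = ∑ d, c d := Equiv.sum_comp (Equiv.subLeft g) c
    rw [Finset.sum_add_distrib, hre, hsum, add_zero]
  simp only [he, Finset.sum_const, nsmul_eq_mul] at htot
  have h0 : c 0 + c g = 0 := by
    rcases mul_eq_zero.mp htot with h | h
    · exfalso
      have : Fintype.card G ≠ 0 := Fintype.card_ne_zero
      simp at h
    · exact h
  rw [hc, hc, ← Finset.sum_add_distrib] at h0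
  rw [← h0]
  refine Finset.sum_congr rfl fun i _ => ?_
  simp only [hJ, add_zero]
  rw [hMs (i + g) i, hNs (i + g) i]
  ring

/-- edge coefficients in cyclic order -/
noncomputable def alph (m : ℕ) (a : ℕ → ℝ) (c : ℕ) : ℝ :=
  if c = 0 then a 1 else if c < m then a (c + 1) else if c = m then a (m + 1)
  else -a (2 * m - c + 1)

/-- diagonal coefficients in cyclic order -/
noncomputable def bet (m : ℕ) (b : ℕ → ℝ) (c : ℕ) : ℝ :=
  if c < m then b (c + 1) else -b (2 * m - c)

/-- cyclic order to matrix index -/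
def phn (m c : ℕ) : ℕ := if c < m then 2 * c else 4 * m - 2 * c - 1

theorem LentU_phn (m : ℕ) (hm : 2 ≤ m) (a : ℕ → ℝ) (c d : ℕ) (hc : c < 2 * m) (hd : d < 2 * m)
    (h : phn m c < phn m d) :
    LentU m a (phn m c + 1) (phn m d + 1) =
      if (d = c + 1 ∨ (c + 1 = 2 * m ∧ d = 0)) then alph m a d
      else if (c = d + 1 ∨ (d + 1 = 2 * m ∧ c = 0)) then alph m a c else 0 := by
  have pc : (c < m ∧ phn m c = 2 * c) ∨ (m ≤ c ∧ phn m c = 4 * m - 2 * c - 1) := by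
    unfold phn; split_ifs with h1
    · exact Or.inl ⟨h1, rfl⟩
    · exact Or.inr ⟨by omega, rfl⟩
  have pd : (d < m ∧ phn m d = 2 * d) ∨ (m ≤ d ∧ phn m d = 4 * m - 2 * d - 1) := by
    unfold phn; split_ifs with h1
    · exact Or.inl ⟨h1, rfl⟩
    · exact Or.inr ⟨by omega, rfl⟩
  generalize phn m c = u at *
  generalize phn m d = v at *
  unfold LentU
  by_cases h1 : u + 1 = 1 ∧ v + 1 = 2
  · rw [if_pos h1, if_neg (by omega), if_pos (by omega)]
    unfold alph
    rw [if_pos (by omega)]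
  rw [if_neg h1]
  by_cases h2 : u + 1 = 2 * m - 1 ∧ v + 1 = 2 * m
  · rw [if_pos h2, if_pos (by omega)]
    unfold alph
    rw [if_neg (by omega), if_neg (by omega), if_pos (by omega)]
  rw [if_neg h2]
  by_cases h3 : v + 1 = u + 1 + 2 ∧ (u + 1) % 2 = 1 ∧ u + 1 ≤ 2 * m - 3
  · rw [if_pos h3, if_pos (by omega)]
    unfold alph
    rw [if_neg (by omega), if_pos (by omega)]
    congr 1; omega
  rw [if_neg h3]
  by_cases h4 : v + 1 = u + 1 + 2 ∧ (u + 1) % 2 = 0 ∧ 1 ≤ u + 1 ∧ u + 1 ≤ 2 * m - 2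
  · rw [if_pos h4, if_neg (by omega), if_pos (by omega)]
    unfold alph
    rw [if_neg (by omega), if_neg (by omega), if_neg (by omega)]
    congr 2; omega
  rw [if_neg h4, if_neg (by omega), if_neg (by omega)]

theorem Lent_phn (m : ℕ) (hm : 2 ≤ m) (a b : ℕ → ℝ) (c d : ℕ) (hc : c < 2 * m) (hd : d < 2 * m) :
    Lent m a b (phn m c + 1) (phn m d + 1) =
      if c = d then bet m b c
      else if (d = c + 1 ∨ (c + 1 = 2 * m ∧ d = 0)) then alph m a d
      else if (c = d + 1 ∨ (d + 1 = 2 * m ∧ c = 0)) then alph m a c else 0 := by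
  by_cases hcd : c = d
  · subst hcd
    simp only [Lent, if_true]
    unfold bet phn
    split_ifs <;> first | omega | rfl | (congr 1; omega) | (congr 2; omega)
  · have hne : phn m c ≠ phn m d := by
      unfold phn; split_ifs <;> omega
    rw [if_neg hcd]
    unfold Lent
    rw [if_neg (by omega)]
    by_cases hlt : phn m c < phn m d
    · rw [if_pos (by omega), LentU_phn m hm a c d hc hd hlt]
    · rw [if_neg (by omega), LentU_phn m hm a d c hd hc (by omega)]
      split_ifs <;> first | omega | rfl 

theorem LentU_add (m : ℕ) (a a' : ℕ → ℝ) (i j : ℕ) :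
    LentU m (fun k => a k + a' k) i j = LentU m a i j + LentU m a' i j := by
  unfold LentU
  split_ifs <;> ring

theorem LentU_smul (m : ℕ) (r : ℝ) (a : ℕ → ℝ) (i j : ℕ) :
    LentU m (fun k => r * a k) i j = r * LentU m a i j := by
  unfold LentU
  split_ifs <;> ring

theorem LMx_add (m : ℕ) (x y : Fin (2*m+1) → ℝ) : LMx m (x + y) = LMx m x + LMx m y := by
  have ha : (fun j => aV m (x + y) j) = fun j => aV m x j + aV m y j := by
    funext j; unfold aV; split_ifs <;> simp
  have hb : (fun j => bV m (x + y) j) = fun j => bV m x j + bV m y j := by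
    funext j; unfold bV; split_ifs <;> simp
  ext i j
  simp only [LMx, LMat, Matrix.add_apply]
  rw [ha, hb]
  unfold Lent
  rw [LentU_add, LentU_add]
  split_ifs <;> ring

theorem LMx_smul (m : ℕ) (r : ℝ) (x : Fin (2*m+1) → ℝ) : LMx m (r • x) = r • LMx m x := by
  have ha : (fun j => aV m (r • x) j) = fun j => r * aV m x j := by
    funext j; unfold aV; split_ifs <;> simp
  have hb : (fun j => bV m (r • x) j) = fun j => r * bV m x j := by
    funext j; unfold bV; split_ifs <;> simp
  ext i j
  simp only [LMx, LMat, Matrix.smul_apply, smul_eq_mul]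
  rw [ha, hb]
  unfold Lent
  rw [LentU_smul, LentU_smul]
  split_ifs <;> ring

/-- `LMx` as a linear map -/
noncomputable def LMlin (m : ℕ) :
    (Fin (2*m+1) → ℝ) →ₗ[ℝ] Matrix (Fin (2*m)) (Fin (2*m)) ℝ where
  toFun := LMx m
  map_add' := LMx_add m
  map_smul' := LMx_smul m

theorem fderiv_trace_pow {E A : Type*} [NormedAddCommGroup E] [NormedSpace ℝ E] [NormedRing A]
    [NormedAlgebra ℝ A] (f : E →L[ℝ] A) (τ : A →L[ℝ] ℝ) (hτ : ∀ a b, τ (a * b) = τ (b * a))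
    (r : ℝ) (n : ℕ) (x v : E) :
    fderiv ℝ (fun y => r * τ (f y ^ n)) x v = r * (n * τ (f x ^ (n - 1) * f v)) := by
  have h2 := (f.hasFDerivAt (x := x)).fun_pow' n
  have h4 := ((τ.hasFDerivAt (x := f x ^ n)).comp x h2).const_mul r
  have h5 : HasFDerivAt (fun y => r * τ (f y ^ n)) _ x := h4
  rw [h5.fderiv]
  have : ∀ i ∈ Finset.range n, τ (f x ^ (n - 1 - i) * f v * f x ^ i)
      = τ (f x ^ (n-1) * f v) := by
    intro i hi
    rw [Finset.mem_range] at hi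
    rw [hτ, ← mul_assoc, ← pow_add]
    congr 3
    omega
  simp [Finset.sum_congr rfl this]

section deriv
attribute [local instance] Matrix.linftyOpNormedRing Matrix.linftyOpNormedAlgebra

theorem fderiv_H2k (m k : ℕ) (hk : 1 ≤ k) (x v : Fin (2*m+1) → ℝ) :
    fderiv ℝ (H2k m k) x v = Matrix.trace (LMx m x ^ (2*k-1) * LMx m v) := by
  have h := fderiv_trace_pow (A := Matrix (Fin (2*m)) (Fin (2*m)) ℝ)
    ⟨LMlin m, (LMlin m).continuous_of_finiteDimensional⟩
    ⟨Matrix.traceLinearMap (Fin (2*m)) ℝ ℝ, LinearMap.continuous_of_finiteDimensional _⟩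
    (fun a b => Matrix.trace_mul_comm a b) (1 / (2 * k : ℝ)) (2 * k) x v
  have hk' : (k : ℝ) ≠ 0 := by positivity
  have h' : fderiv ℝ (H2k m k) x v =
    (1 / (2 * k : ℝ)) * (((2 * k : ℕ) : ℝ) * Matrix.trace (LMx m x ^ (2*k-1) * LMx m v)) := h
  rw [h']
  push_cast
  field_simp

end deriv

/-- The Lax matrix in cyclic order -/
noncomputable def Lc (m : ℕ) (x : Fin (2*m+1) → ℝ) : Matrix (Fin (2*m)) (Fin (2*m)) ℝ :=
  fun c d =>
      if (c : ℕ) = d then bet m (bV m x) c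
      else if ((d : ℕ) = c + 1 ∨ ((c : ℕ) + 1 = 2 * m ∧ (d : ℕ) = 0)) then alph m (aV m x) d
      else if ((c : ℕ) = d + 1 ∨ ((d : ℕ) + 1 = 2 * m ∧ (c : ℕ) = 0)) then alph m (aV m x) c else 0

theorem exists_phi (m : ℕ) : ∃ e : Fin (2*m) ≃ Fin (2*m), ∀ c, (e c : ℕ) = phn m c := by
  have hlt : ∀ c : Fin (2*m), phn m c < 2 * m := by
    intro c; have := c.2; unfold phn; split_ifs <;> omega
  have hinj : Function.Injective (fun c : Fin (2*m) => (⟨phn m c, hlt c⟩ : Fin (2*m))) := by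
    intro c d h
    have hc := c.2
    have hd := d.2
    simp only [Fin.mk.injEq] at h
    apply Fin.ext
    unfold phn at h
    split_ifs at h <;> omega
  exact ⟨Equiv.ofBijective _ (Finite.injective_iff_bijective.mp hinj), fun c => rfl⟩

theorem trace_Lc (m : ℕ) (hm : 2 ≤ m) (k : ℕ) (x v : Fin (2*m+1) → ℝ) :
    Matrix.trace (LMx m x ^ k * LMx m v) = Matrix.trace (Lc m x ^ k * Lc m v) := by
  obtain ⟨e, he⟩ := exists_phi m
  have hL : ∀ y, Lc m y = Matrix.reindexAlgEquiv ℝ ℝ e.symm (LMx m y) := by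
    intro y
    ext c d
    simp only [Matrix.coe_reindexAlgEquiv, Matrix.reindex_apply, Matrix.submatrix_apply,
      Equiv.symm_symm, LMx, LMat, he]
    rw [Lent_phn m hm _ _ _ _ c.2 d.2]
    rfl
  rw [hL, hL, ← map_pow, ← map_mul]
  simp only [Matrix.coe_reindexAlgEquiv, Matrix.reindex_apply, Matrix.trace, Matrix.diag,
    Matrix.submatrix_apply, Equiv.symm_symm]
  exact (Equiv.sum_comp e (fun i => (LMx m x ^ k * LMx m v) i i)).symm

theorem fin_add_one_val {n : ℕ} [NeZero n] (hn : 2 ≤ n) (c : Fin n) :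
    ((c + 1 : Fin n) : ℕ) = if (c : ℕ) + 1 = n then 0 else (c : ℕ) + 1 := by
  have h1 : ((1 : Fin n) : ℕ) = 1 := by
    rw [Fin.val_one', Nat.mod_eq_of_lt (by omega)]
  rw [Fin.val_add, h1]
  split_ifs with h
  · rw [h, Nat.mod_self]
  · exact Nat.mod_eq_of_lt (by omega)

theorem fin_sub_one_val {n : ℕ} [NeZero n] (hn : 2 ≤ n) (c : Fin n) :
    ((c - 1 : Fin n) : ℕ) = if (c : ℕ) = 0 then n - 1 else (c : ℕ) - 1 := by
  have h := fin_add_one_val hn (c - 1)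
  rw [sub_add_cancel] at h
  have := (c - 1).2
  split_ifs at * <;> omega

theorem Lc_symm (m : ℕ) (hm : 2 ≤ m) (x : Fin (2*m+1) → ℝ) (c d : Fin (2*m)) :
    Lc m x c d = Lc m x d c := by
  have hc := c.2
  have hd := d.2
  unfold Lc
  split_ifs with h1 <;> first | omega | rfl | (rw [h1])

theorem Lc_ind (m : ℕ) (hm : 2 ≤ m) [NeZero (2*m)] (x : Fin (2*m+1) → ℝ) (c d : Fin (2*m)) :
    Lc m x c d = (if d = c then bet m (bV m x) c else 0)
      + (if d = c + 1 then alph m (aV m x) d else 0)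
      + (if d = c - 1 then alph m (aV m x) c else 0) := by
  have hc := c.2
  have hd := d.2
  unfold Lc
  simp only [Fin.ext_iff, fin_add_one_val (n := 2*m) (by omega), fin_sub_one_val (n := 2*m) (by omega)]
  have e2 : ((d : ℕ) = if (c : ℕ) + 1 = 2 * m then 0 else (c : ℕ) + 1) ↔
    ((d : ℕ) = c + 1 ∨ ((c : ℕ) + 1 = 2 * m ∧ (d : ℕ) = 0)) := by split_ifs <;> omega
  have e3 : ((d : ℕ) = if (c : ℕ) = 0 then 2 * m - 1 else (c : ℕ) - 1) ↔
    ((c : ℕ) = d + 1 ∨ ((d : ℕ) + 1 = 2 * m ∧ (c : ℕ) = 0)) := by split_ifs <;> omega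
  simp only [e2, e3, eq_comm (a := (d : ℕ)) (b := (c : ℕ))]
  clear e2 e3
  split_ifs <;> first | omega | simp

theorem Lc_row (m : ℕ) (hm : 2 ≤ m) [NeZero (2*m)] (x : Fin (2*m+1) → ℝ) (c : Fin (2*m))
    (f : Fin (2*m) → ℝ) :
    ∑ d, Lc m x c d * f d = bet m (bV m x) c * f c
      + alph m (aV m x) (c + 1 : Fin (2*m)) * f (c + 1) + alph m (aV m x) c * f (c - 1) := by
  simp only [Lc_ind m hm, add_mul, Finset.sum_add_distrib, ite_mul, zero_mul,
    Finset.sum_ite_eq', Finset.mem_univ, if_true]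

theorem Lc_trace (m : ℕ) (hm : 2 ≤ m) [NeZero (2*m)] (v : Fin (2*m+1) → ℝ)
    (N : Matrix (Fin (2*m)) (Fin (2*m)) ℝ) (hN : ∀ c d, N c d = N d c) :
    Matrix.trace (N * Lc m v) = ∑ c : Fin (2*m), (bet m (bV m v) c * N c c
      + 2 * (alph m (aV m v) c * N (c - 1) c)) := by
  rw [Matrix.trace_mul_comm]
  simp only [Matrix.trace, Matrix.diag, Matrix.mul_apply]
  simp only [Lc_row m hm]
  rw [Finset.sum_add_distrib, Finset.sum_add_distrib, Finset.sum_add_distrib]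
  have h := Equiv.sum_comp (Equiv.addRight (1 : Fin (2*m)))
    (fun c => alph m (aV m v) c * N (c - 1) c)
  simp only [Equiv.coe_addRight, add_sub_cancel_right] at h
  simp only [hN (_ + 1) _]
  rw [h, ← Finset.mul_sum]
  ring

/-- sign twist -/
noncomputable def eps (m c : ℕ) : ℝ := if c < m then 1 else -1

theorem eps_sq (m c : ℕ) : eps m c * eps m c = 1 := by
  unfold eps; split_ifs <;> norm_num

/-- twisted reflection -/
noncomputable def tw (m : ℕ) (A : Matrix (Fin (2*m)) (Fin (2*m)) ℝ) :
    Matrix (Fin (2*m)) (Fin (2*m)) ℝ :=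
  fun c d => eps m c * eps m d * A c.rev d.rev

theorem tw_mul (m : ℕ) (A B : Matrix (Fin (2*m)) (Fin (2*m)) ℝ) :
    tw m (A * B) = tw m A * tw m B := by
  ext c d
  simp only [tw, Matrix.mul_apply]
  rw [← Equiv.sum_comp Fin.revPerm, Finset.mul_sum]
  refine Finset.sum_congr rfl fun k _ => ?_
  simp only [Fin.revPerm_apply]
  linear_combination (- eps m c * eps m d * A c.rev k.rev * B k.rev d.rev) * eps_sq m k

theorem tw_Lc (m : ℕ) (hm : 2 ≤ m) (x : Fin (2*m+1) → ℝ) : tw m (Lc m x) = - Lc m x := by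
  ext c d
  have hc := c.2
  have hd := d.2
  simp only [tw, Matrix.neg_apply, Lc, Fin.val_rev]
  generalize (c : ℕ) = u at *
  generalize (d : ℕ) = v at *
  by_cases h1 : u = v
  · rw [if_pos h1, if_pos (by omega)]
    subst h1
    rw [eps_sq]
    unfold bet
    by_cases h : u < m
    · rw [if_pos h, if_neg (by omega), show 2 * m - (2 * m - (u + 1)) = u + 1 by omega]; ring
    · rw [if_neg h, if_pos (by omega), show 2 * m - (u + 1) + 1 = 2 * m - u by omega]; ring
  rw [if_neg h1, if_neg (by omega)]
  have key : ∀ u v : ℕ, u < 2 * m → v < 2 * m → (v = u + 1 ∨ (u + 1 = 2 * m ∧ v = 0)) →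
      eps m u * eps m v * alph m (aV m x) (2 * m - (u + 1)) = - alph m (aV m x) v := by
    intro u v hu hv h
    unfold eps alph
    by_cases hv0 : v = 0
    · rw [if_neg (by omega), if_pos (by omega), if_pos (by omega), if_pos (by omega)]; ring
    by_cases hvm : v < m
    · rw [if_pos (by omega), if_pos (by omega), if_neg (by omega), if_neg (by omega),
        if_neg (by omega), if_neg (by omega), if_pos (by omega),
        show 2 * m - (2 * m - (u + 1)) + 1 = v + 1 by omega]; ring
    by_cases hvm' : v = m
    · rw [if_pos (by omega), if_neg (by omega), if_neg (by omega), if_neg (by omega),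
        if_pos (by omega), if_neg (by omega), if_neg (by omega), if_pos (by omega)]; ring
    · rw [if_neg (by omega), if_neg (by omega), if_neg (by omega), if_pos (by omega),
        if_neg (by omega), if_neg (by omega), if_neg (by omega),
        show 2 * m - (u + 1) + 1 = 2 * m - v + 1 by omega]; ring
  by_cases h2 : (v = u + 1 ∨ (u + 1 = 2 * m ∧ v = 0))
  · rw [if_pos h2, if_neg (by omega), if_pos (by omega)]
    exact key u v hc hd h2
  rw [if_neg h2]
  by_cases h3 : (u = v + 1 ∨ (v + 1 = 2 * m ∧ u = 0))
  · rw [if_pos h3, if_pos (by omega), mul_comm (eps m u)]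
    exact key v u hd hc h3
  rw [if_neg h3, if_neg (by omega), if_neg (by omega)]
  simp

theorem tw_pow (m : ℕ) (hm : 2 ≤ m) (x : Fin (2*m+1) → ℝ) (k : ℕ) :
    tw m (Lc m x ^ k) = (- Lc m x) ^ k := by
  induction k with
  | zero =>
    ext c d
    simp only [tw, pow_zero, Matrix.one_apply, Fin.rev_inj]
    split_ifs with h
    · rw [h, mul_one, eps_sq]
    · simp
  | succ k ih => rw [pow_succ, tw_mul, ih, tw_Lc m hm, pow_succ]

/-- The matrix facts about odd powers needed for gradients. -/
structure OddLike (m : ℕ) (N : Matrix (Fin (2*m)) (Fin (2*m)) ℝ) : Prop where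
  symm : ∀ c d, N c d = N d c
  anti : ∀ c d : Fin (2*m), eps m c * eps m d * N c.rev d.rev = - N c d

theorem Lc_pow_symm (m : ℕ) (hm : 2 ≤ m) (x : Fin (2*m+1) → ℝ) (k : ℕ) (c d : Fin (2*m)) :
    (Lc m x ^ k) c d = (Lc m x ^ k) d c := by
  have h1 : (Lc m x).transpose = Lc m x := by
    ext c d; exact Lc_symm m hm x d c
  have h : (Lc m x ^ k).transpose = Lc m x ^ k := by
    rw [Matrix.transpose_pow, h1]
  exact (congrFun (congrFun h c) d).symm

theorem oddLike_pow (m : ℕ) (hm : 2 ≤ m) (x : Fin (2*m+1) → ℝ) (k : ℕ) (hk : 1 ≤ k) :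
    OddLike m (Lc m x ^ (2 * k - 1)) := by
  refine ⟨Lc_pow_symm m hm x _, fun c d => ?_⟩
  have h := tw_pow m hm x (2 * k - 1)
  rw [Odd.neg_pow (by rw [Nat.odd_iff]; omega)] at h
  exact congrFun (congrFun h c) d

theorem OddLike.diag {m : ℕ} {N : Matrix (Fin (2*m)) (Fin (2*m)) ℝ} (h : OddLike m N)
    (c d : Fin (2*m)) (hcd : (c : ℕ) + d + 1 = 2 * m) : N d d = - N c c := by
  have := h.anti c c
  rw [eps_sq, one_mul] at this
  have e : d = c.rev := by apply Fin.ext; rw [Fin.val_rev]; omega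
  rw [e, this]

theorem OddLike.edge {m : ℕ} [NeZero (2*m)] {N : Matrix (Fin (2*m)) (Fin (2*m)) ℝ}
    (h : OddLike m N)
    (c d : Fin (2*m)) (hc0 : 0 < (c : ℕ)) (hc : (c : ℕ) < m) (hcd : (c : ℕ) + d = 2 * m) :
    N (d - 1) d = - N (c - 1) c := by
  have h1 := fin_sub_one_val (n := 2*m) (by omega) c
  have h2 := fin_sub_one_val (n := 2*m) (by omega) d
  rw [if_neg (by omega)] at h1 h2
  have := h.anti (c - 1) c
  have e1 : d = (c - 1).rev := by apply Fin.ext; rw [Fin.val_rev]; omega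
  have e2 : d - 1 = c.rev := by apply Fin.ext; rw [Fin.val_rev]; omega
  rw [h.symm, e2, ← this, e1, h1]
  unfold eps
  rw [if_pos (by omega), if_pos hc]; ring

theorem aV_single (m : ℕ) (q : Fin (2*m+1)) (j : ℕ) :
    aV m (Pi.single q 1) j = if 1 ≤ j ∧ j ≤ m + 1 ∧ j = (q : ℕ) + 1 then 1 else 0 := by
  unfold aV
  split_ifs with h1 h2 h2
  · rw [Pi.single_apply, if_pos (by apply Fin.ext; simp only; omega)]
  · rw [Pi.single_apply, if_neg (by rw [Fin.ext_iff]; simp only; omega)]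
  · omega
  · rfl

theorem bV_single (m : ℕ) (q : Fin (2*m+1)) (j : ℕ) :
    bV m (Pi.single q 1) j = if 1 ≤ j ∧ j ≤ m ∧ m + j = (q : ℕ) then 1 else 0 := by
  unfold bV
  split_ifs with h1 h2 h2
  · rw [Pi.single_apply, if_pos (by apply Fin.ext; simp only; omega)]
  · rw [Pi.single_apply, if_neg (by rw [Fin.ext_iff]; simp only; omega)]
  · omega
  · rfl

theorem grad_b (m : ℕ) (hm : 2 ≤ m) [NeZero (2*m)] {N : Matrix (Fin (2*m)) (Fin (2*m)) ℝ}
    (h : OddLike m N) (q : Fin (2*m+1)) (c : Fin (2*m)) (hq : (q : ℕ) = m + c + 1) :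
    Matrix.trace (N * Lc m (Pi.single q 1)) = 2 * N c c := by
  have hq2 := q.2
  rw [Lc_trace m hm _ N h.symm]
  have ha : ∀ e : Fin (2*m), alph m (aV m (Pi.single q 1)) e = 0 := by
    intro e
    have he := e.2
    unfold alph
    simp only [aV_single]
    split_ifs <;> first | omega | simp
  have hb : ∀ e : Fin (2*m), bet m (bV m (Pi.single q 1)) e
      = (if e = c then 1 else 0) - (if e = c.rev then 1 else 0) := by
    intro e
    have he := e.2
    unfold bet
    simp only [bV_single, Fin.ext_iff, Fin.val_rev]
    split_ifs <;> first | omega | simp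
  simp only [ha, hb, sub_mul, ite_mul, zero_mul, one_mul, mul_zero, add_zero,
    Finset.sum_sub_distrib, Finset.sum_ite_eq', Finset.mem_univ, if_true]
  rw [h.diag c c.rev (by rw [Fin.val_rev]; omega)]
  ring

theorem grad_a (m : ℕ) (hm : 2 ≤ m) [NeZero (2*m)] {N : Matrix (Fin (2*m)) (Fin (2*m)) ℝ}
    (h : OddLike m N) (q : Fin (2*m+1)) (c : Fin (2*m)) (hq : (q : ℕ) = c) (hcm : (c : ℕ) ≤ m) :
    Matrix.trace (N * Lc m (Pi.single q 1)) =
      (if (c : ℕ) = 0 ∨ (c : ℕ) = m then 2 else 4) * N (c - 1) c := by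
  rw [Lc_trace m hm _ N h.symm]
  have hb : ∀ e : Fin (2*m), bet m (bV m (Pi.single q 1)) e = 0 := by
    intro e
    have he := e.2
    unfold bet
    simp only [bV_single]
    split_ifs <;> first | omega | simp
  by_cases hc : (c : ℕ) = 0 ∨ (c : ℕ) = m
  · have ha : ∀ e : Fin (2*m), alph m (aV m (Pi.single q 1)) e = if e = c then 1 else 0 := by
      intro e
      have he := e.2
      unfold alph
      simp only [aV_single, Fin.ext_iff]
      split_ifs <;> first | omega | simp
    simp only [ha, hb, ite_mul, zero_mul, one_mul, zero_add, ← Finset.mul_sum,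
      Finset.sum_ite_eq', Finset.mem_univ, if_true]
    rw [if_pos hc]
  · have hlt : 2 * m - (c : ℕ) < 2 * m := by omega
    have ha : ∀ e : Fin (2*m), alph m (aV m (Pi.single q 1)) e
        = (if e = c then 1 else 0) - (if e = ⟨2 * m - c, hlt⟩ then 1 else 0) := by
      intro e
      have he := e.2
      unfold alph
      simp only [aV_single, Fin.ext_iff]
      split_ifs <;> first | omega | simp
    simp only [ha, hb, sub_mul, ite_mul, zero_mul, one_mul, zero_add, ← Finset.mul_sum,
      Finset.sum_sub_distrib, Finset.sum_ite_eq', Finset.mem_univ, if_true]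
    rw [if_neg hc, h.edge c ⟨2 * m - c, hlt⟩ (by omega) (by omega) (by simp only; omega)]
    ring

theorem alph_le (m : ℕ) (a : ℕ → ℝ) (c : ℕ) (hc : c ≤ m) : alph m a c = a (c + 1) := by
  unfold alph
  split_ifs with h1 h2 h3
  · rw [h1]
  · rfl
  · rw [h3]
  · omega

theorem alph_gt (m : ℕ) (a : ℕ → ℝ) (c : ℕ) (hc : m < c) : alph m a c = - a (2 * m - c + 1) := by
  unfold alph
  rw [if_neg (by omega), if_neg (by omega), if_neg (by omega)]

theorem vf_a (m : ℕ) (hm : 2 ≤ m) [NeZero (2*m)] (x : Fin (2*m+1) → ℝ)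
    {N : Matrix (Fin (2*m)) (Fin (2*m)) ℝ} (h : OddLike m N) (p : Fin (2*m+1)) (c : Fin (2*m))
    (hp : (p : ℕ) = c) (hcm : (c : ℕ) ≤ m) :
    ∑ q, pi1M m x p q * Matrix.trace (N * Lc m (Pi.single q 1)) =
      aV m x (c + 1) * (N c c - N (c - 1) (c - 1)) := by
  have hs := fin_sub_one_val (n := 2*m) (by omega) c
  by_cases h0 : (c : ℕ) = 0
  · rw [if_pos h0] at hs
    rw [Fintype.sum_eq_single (⟨m + 1, by omega⟩ : Fin (2*m+1))]
    · rw [grad_b m hm h _ c (by simp only; omega), h.diag c (c - 1) (by omega)]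
      unfold pi1M pi1ab
      simp only
      rw [if_pos (by omega), if_pos (by omega), h0]
      ring
    · intro q hq
      have hq' : (q : ℕ) ≠ m + 1 := fun e => hq (Fin.ext e)
      unfold pi1M pi1ab
      split_ifs <;> first | omega | simp
  rw [if_neg h0] at hs
  by_cases h1 : (c : ℕ) = m
  · rw [Fintype.sum_eq_single (⟨2 * m, by omega⟩ : Fin (2*m+1))]
    · rw [grad_b m hm h _ (c - 1) (by simp only; omega), h.diag (c - 1) c (by omega)]
      unfold pi1M pi1ab
      simp only
      rw [if_pos (by omega), if_neg (by omega), if_neg (by omega), if_neg (by omega),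
        if_pos (by omega), h1]
      ring
    · intro q hq
      have hq' : (q : ℕ) ≠ 2 * m := fun e => hq (Fin.ext e)
      have hq2 := q.2
      unfold pi1M pi1ab
      split_ifs <;> first | omega | simp
  · rw [Fintype.sum_eq_add (⟨m + c, by omega⟩ : Fin (2*m+1)) (⟨m + c + 1, by omega⟩ : Fin (2*m+1))
      (by rw [Ne, Fin.ext_iff]; simp only; omega)]
    · rw [grad_b m hm h _ (c - 1) (by simp only; omega), grad_b m hm h _ c (by simp only)]
      unfold pi1M pi1ab
      simp only
      rw [if_pos (by omega), if_neg (by omega), if_neg (by omega), if_pos (by omega),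
        if_pos (by omega), if_neg (by omega), if_pos (by omega), hp]
      ring
    · intro q hq
      have hq1 : (q : ℕ) ≠ m + c := fun e => hq.1 (Fin.ext e)
      have hq2 : (q : ℕ) ≠ m + c + 1 := fun e => hq.2 (Fin.ext e)
      have hq3 := q.2
      unfold pi1M pi1ab
      split_ifs <;> first | omega | simp

theorem vf_b (m : ℕ) (hm : 2 ≤ m) [NeZero (2*m)] (x : Fin (2*m+1) → ℝ)
    {N : Matrix (Fin (2*m)) (Fin (2*m)) ℝ} (h : OddLike m N) (p : Fin (2*m+1)) (c : Fin (2*m))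
    (hp : (p : ℕ) = m + c + 1) (hcm : (c : ℕ) < m) :
    ∑ q, pi1M m x p q * Matrix.trace (N * Lc m (Pi.single q 1)) =
      2 * (aV m x (c + 2) * N c (c + 1) - aV m x (c + 1) * N (c - 1) c) := by
  have hs := fin_add_one_val (n := 2*m) (by omega) c
  rw [if_neg (by omega)] at hs
  rw [Fintype.sum_eq_add (⟨c, by omega⟩ : Fin (2*m+1)) (⟨c + 1, by omega⟩ : Fin (2*m+1))
      (by rw [Ne, Fin.ext_iff]; simp only; omega)]
  · rw [grad_a m hm h _ c rfl (by omega), grad_a m hm h _ (c + 1) (by simp only; omega) (by omega),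
      add_sub_cancel_right]
    have e1 : pi1M m x p ⟨c, by omega⟩ * (if (c : ℕ) = 0 ∨ (c : ℕ) = m then 2 else 4)
        = - (2 * aV m x (c + 1)) := by
      unfold pi1M pi1ab
      simp only
      rw [if_neg (by omega), if_pos (by omega)]
      by_cases h0 : (c : ℕ) = 0
      · rw [if_pos (by omega), if_pos (by omega), h0]; ring
      · rw [if_neg (by omega), if_pos (by omega), if_neg (by omega)]; ring
    have e2 : pi1M m x p ⟨c + 1, by omega⟩ *
        (if ((c + 1 : Fin (2*m)) : ℕ) = 0 ∨ ((c + 1 : Fin (2*m)) : ℕ) = m then 2 else 4)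
        = 2 * aV m x (c + 2) := by
      unfold pi1M pi1ab
      simp only
      rw [if_neg (by omega), if_pos (by omega), if_neg (by omega), if_neg (by omega)]
      by_cases h0 : (c : ℕ) + 1 = m
      · rw [if_neg (by omega), if_pos (by omega), if_pos (by omega),
          show (c : ℕ) + 2 = m + 1 by omega]; ring
      · rw [if_pos (by omega), if_neg (by omega)]; ring
    rw [← mul_assoc, ← mul_assoc, e1, e2]
    ring
  · intro q hq
    have hq1 : (q : ℕ) ≠ c := fun e => hq.1 (Fin.ext e)
    have hq2 : (q : ℕ) ≠ c + 1 := fun e => hq.2 (Fin.ext e)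
    have hq3 := q.2
    unfold pi1M pi1ab
    split_ifs <;> first | omega | simp

theorem alph_vf (m : ℕ) (hm : 2 ≤ m) [NeZero (2*m)] (x X : Fin (2*m+1) → ℝ)
    {N : Matrix (Fin (2*m)) (Fin (2*m)) ℝ} (h : OddLike m N)
    (hX : ∀ p, X p = ∑ q, pi1M m x p q * Matrix.trace (N * Lc m (Pi.single q 1)))
    (c : Fin (2*m)) :
    alph m (aV m X) c = alph m (aV m x) c * (N c c - N (c - 1) (c - 1)) := by
  have hc2 := c.2
  have hle : ∀ c : Fin (2*m), (c : ℕ) ≤ m →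
      aV m X (c + 1) = aV m x (c + 1) * (N c c - N (c - 1) (c - 1)) := by
    intro c hc
    have e : aV m X (c + 1) = X ⟨c, by omega⟩ := by
      unfold aV
      rw [dif_pos (by omega)]
      rfl
    rw [e, hX, vf_a m hm x h _ c rfl hc]
  by_cases hc : (c : ℕ) ≤ m
  · rw [alph_le _ _ _ hc, alph_le _ _ _ hc, hle c hc]
  · rw [alph_gt _ _ _ (by omega), alph_gt _ _ _ (by omega)]
    obtain ⟨d, hdv⟩ : ∃ d : Fin (2*m), (d : ℕ) = 2 * m - c := ⟨⟨2 * m - c, by omega⟩, rfl⟩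
    have hd := hle d (by omega)
    have h1 := fin_sub_one_val (n := 2*m) (by omega) c
    have h2 := fin_sub_one_val (n := 2*m) (by omega) d
    rw [if_neg (by omega)] at h1 h2
    rw [← hdv, hd, h.diag c (d - 1) (by omega), h.diag (c - 1) d (by omega)]
    ring

theorem edge_flip (m : ℕ) [NeZero (2*m)] (x : Fin (2*m+1) → ℝ)
    {N : Matrix (Fin (2*m)) (Fin (2*m)) ℝ} (h : OddLike m N) (c d : Fin (2*m))
    (hcd : (c : ℕ) + d = 2 * m) :
    alph m (aV m x) c * N (c - 1) c = alph m (aV m x) d * N (d - 1) d := by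
  have main : ∀ c d : Fin (2*m), (c : ℕ) + d = 2 * m → (c : ℕ) < m →
      alph m (aV m x) c * N (c - 1) c = alph m (aV m x) d * N (d - 1) d := by
    intro c d hcd hc
    have := d.2
    rw [h.edge c d (by omega) hc hcd, alph_le _ _ _ hc.le, alph_gt _ _ _ (by omega),
      show 2 * m - (d : ℕ) + 1 = c + 1 by omega]
    ring
  rcases lt_trichotomy (c : ℕ) m with hc | hc | hc
  · exact main c d hcd hc
  · have : c = d := Fin.ext (by omega)
    rw [this]
  · exact (main d c (by omega) (by omega)).symm

theorem bet_vf (m : ℕ) (hm : 2 ≤ m) [NeZero (2*m)] (x X : Fin (2*m+1) → ℝ)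
    {N : Matrix (Fin (2*m)) (Fin (2*m)) ℝ} (h : OddLike m N)
    (hX : ∀ p, X p = ∑ q, pi1M m x p q * Matrix.trace (N * Lc m (Pi.single q 1)))
    (c : Fin (2*m)) :
    bet m (bV m X) c = 2 * (alph m (aV m x) (c + 1 : Fin (2*m)) * N c (c + 1)
      - alph m (aV m x) c * N (c - 1) c) := by
  have hc2 := c.2
  have hle : ∀ c : Fin (2*m), (c : ℕ) < m →
      bV m X (c + 1) = 2 * (alph m (aV m x) (c + 1 : Fin (2*m)) * N c (c + 1)
      - alph m (aV m x) c * N (c - 1) c) := by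
    intro c hc
    have e : bV m X (c + 1) = X ⟨m + c + 1, by omega⟩ := by
      unfold bV
      rw [dif_pos (by omega)]
      rfl
    have hs := fin_add_one_val (n := 2*m) (by omega) c
    rw [if_neg (by omega)] at hs
    rw [e, hX, vf_b m hm x h _ c rfl hc, alph_le _ _ _ (by omega), alph_le _ _ _ (by omega), hs]
  unfold bet
  by_cases hc : (c : ℕ) < m
  · rw [if_pos hc, hle c hc]
  · rw [if_neg hc]
    have hr := Fin.val_rev c
    have hd := hle c.rev (by omega)
    have hs := fin_add_one_val (n := 2*m) (by omega) c.rev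
    rw [if_neg (by omega)] at hs
    have e1 := edge_flip m x h c (c.rev + 1) (by omega)
    rw [add_sub_cancel_right] at e1
    have e2 : alph m (aV m x) (c + 1 : Fin (2*m)) * N c (c + 1)
        = alph m (aV m x) c.rev * N (c.rev - 1) c.rev := by
      have hs' := fin_add_one_val (n := 2*m) (by omega) c
      by_cases hl : (c : ℕ) + 1 = 2 * m
      · rw [if_pos hl] at hs'
        have : c + 1 = c.rev := Fin.ext (by omega)
        rw [← this, add_sub_cancel_right]
      · rw [if_neg hl] at hs'
        have := edge_flip m x h (c + 1) c.rev (by omega)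
        rw [add_sub_cancel_right] at this
        exact this
    rw [show 2 * m - (c : ℕ) = c.rev + 1 by omega, hd, ← e1, e2]
    ring

theorem fin_gen {n : ℕ} [NeZero n] (hn : 2 ≤ n) (P : Fin n → Prop) (h0 : P 0)
    (hs : ∀ x, P x → P (x + 1)) (x : Fin n) : P x := by
  have : ∀ k : ℕ, ∀ hk : k < n, P ⟨k, hk⟩ := by
    intro k
    induction k with
    | zero => intro hk; exact h0
    | succ k ih =>
      intro hk
      have h := hs _ (ih (by omega))
      have hv := fin_add_one_val hn (⟨k, by omega⟩ : Fin n)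
      rw [if_neg (by simp only; omega)] at hv
      have e : (⟨k, by omega⟩ : Fin n) + 1 = ⟨k + 1, hk⟩ := Fin.ext hv
      rwa [e] at h
  exact this x x.2

theorem Lc_comm_rows (m : ℕ) (hm : 2 ≤ m) [NeZero (2*m)] (x : Fin (2*m+1) → ℝ) (k : ℕ)
    (i j : Fin (2*m)) (α : Fin (2*m) → ℝ) (hα : ∀ c, α c = alph m (aV m x) c) :
    bet m (bV m x) i * (Lc m x ^ k) i j + α (i + 1) * (Lc m x ^ k) (i + 1) j
      + α i * (Lc m x ^ k) (i - 1) j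
    = bet m (bV m x) j * (Lc m x ^ k) i j + α (j + 1) * (Lc m x ^ k) i (j + 1)
      + α j * (Lc m x ^ k) i (j - 1) := by
  have h : (Lc m x * Lc m x ^ k) i j = (Lc m x ^ k * Lc m x) i j := by
    rw [← pow_succ, ← pow_succ']
  rw [Matrix.mul_apply, Matrix.mul_apply, Lc_row m hm] at h
  have h2 := Lc_row m hm x j (fun d => (Lc m x ^ k) i d)
  simp only [hα]
  rw [h, ← h2]
  refine Finset.sum_congr rfl fun d _ => ?_
  rw [Lc_symm m hm x d j, mul_comm]

/-- the functions `H_2, H_4, …, H_{2m}` are in involution with respect to `π₁`: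
`(∇H_{2i})ᵀ π₁ ∇H_{2j} = 0` at every point of `ℝ^{2m+1}`. -/
theorem H2k_in_involution (m : ℕ) (hm : 2 ≤ m) (i j : ℕ)
    (hi1 : 1 ≤ i) (hi2 : i ≤ m) (hj1 : 1 ≤ j) (hj2 : j ≤ m) (x : Fin (2*m+1) → ℝ) :
    ∑ p : Fin (2*m+1), ∑ q : Fin (2*m+1),
      fderiv ℝ (H2k m i) x (Pi.single p 1) * pi1M m x p q *
        fderiv ℝ (H2k m j) x (Pi.single q 1) = 0 := by
  have : NeZero (2*m) := ⟨by omega⟩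
  obtain ⟨X, hX⟩ : ∃ X : Fin (2*m+1) → ℝ, ∀ p, X p = ∑ q, pi1M m x p q *
    Matrix.trace (Lc m x ^ (2*j-1) * Lc m (Pi.single q 1)) := ⟨_, fun _ => rfl⟩
  have hM := oddLike_pow m hm x i hi1
  have hN := oddLike_pow m hm x j hj1
  have hG : ∀ q, fderiv ℝ (H2k m j) x (Pi.single q 1)
      = Matrix.trace (Lc m x ^ (2*j-1) * Lc m (Pi.single q 1)) := by
    intro q
    rw [fderiv_H2k m j hj1, trace_Lc m hm]
  have hF : ∑ p, ∑ q, fderiv ℝ (H2k m i) x (Pi.single p 1) * pi1M m x p q *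
        fderiv ℝ (H2k m j) x (Pi.single q 1) = fderiv ℝ (H2k m i) x X := by
    have h1 := LinearMap.pi_apply_eq_sum_univ (fderiv ℝ (H2k m i) x).toLinearMap X
    have h2 : fderiv ℝ (H2k m i) x X
        = ∑ p, X p • fderiv ℝ (H2k m i) x (fun j => if p = j then 1 else 0) := h1
    rw [h2]
    refine Finset.sum_congr rfl fun p _ => ?_
    have e : (fun j => if p = j then (1 : ℝ) else 0) = Pi.single p 1 := by
      funext t; rw [Pi.single_apply]; simp only [eq_comm]
    rw [e, hX, smul_eq_mul, Finset.sum_mul]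
    refine Finset.sum_congr rfl fun q _ => ?_
    rw [hG]; ring
  rw [hF, fderiv_H2k m i hi1, trace_Lc m hm, Lc_trace m hm X _ hM.symm]
  have core := core_cyc (1 : Fin (2*m)) (fin_gen (by omega))
    (fun c => alph m (aV m x) c) (fun c => bet m (bV m x) c)
    (fun c d => (Lc m x ^ (2*i-1)) c d) (fun c d => (Lc m x ^ (2*j-1)) c d)
    hM.symm hN.symm
    (fun c d => Lc_comm_rows m hm x _ c d _ (fun _ => rfl))
    (fun c d => Lc_comm_rows m hm x _ c d _ (fun _ => rfl))
    (fun c d => by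
      rw [← Matrix.mul_apply, ← Matrix.mul_apply, ← pow_add, ← pow_add, add_comm])
  generalize Lc m x ^ (2*i-1) = M at *
  generalize Lc m x ^ (2*j-1) = N at *
  simp only [alph_vf m hm x X hN hX, bet_vf m hm x X hN hX]
  rw [Finset.sum_add_distrib]
  have sh := Equiv.sum_comp (Equiv.addRight (1 : Fin (2*m)))
    (fun c : Fin (2*m) => 2 * (alph m (aV m x) c * (N c c - N (c - 1) (c - 1)) * M (c - 1) c))
  have sh2 := Equiv.sum_comp (Equiv.addRight (1 : Fin (2*m)))
    (fun c : Fin (2*m) => 2 * (alph m (aV m x) c * N (c - 1) c) * M c c)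
  simp only [Equiv.coe_addRight, add_sub_cancel_right] at sh sh2
  rw [← sh]
  clear sh
  have eL : ∀ c : Fin (2*m), 2 * (alph m (aV m x) (c + 1 : Fin (2*m)) * N c (c + 1)
      - alph m (aV m x) c * N (c - 1) c) * M c c
      = 2 * (alph m (aV m x) (c + 1 : Fin (2*m)) * N c (c + 1)) * M c c
      - 2 * (alph m (aV m x) c * N (c - 1) c) * M c c := fun c => by ring
  simp only [eL]
  rw [Finset.sum_sub_distrib, ← sh2, ← Finset.sum_sub_distrib, ← Finset.sum_add_distrib]
  have core2 := congrArg (fun t : ℝ => 2 * t) core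
  simp only [mul_zero, Finset.mul_sum] at core2
  rw [← core2]
  refine Finset.sum_congr rfl fun c _ => ?_
  ring
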